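/- There exist disjoint context-free languages L₀, L₁ over the alphabet {0,1} such that L₀ ∪ L₁ has the prefix property and, for every p ∈ (0,1), P_p(L₀ ∪ L₁) = 1 and P_p(L₁) = √p. (An f(p)-coin with f(p) = √p can be simulated by a pushdown automaton.) -/

import Mathlib

/-- Probability of a word `w` under i.i.d. `p`-coin tosses. -/
noncomputable def wordProb (p : ℝ) (w : List Bool) : ℝ :=
  p ^ (w.count true) * (1 - p) ^ (w.count false)

/-- Probability of a language under i.i.d. `p`-coin tosses. -/
noncomputable def langProb (p : ℝ) (L : Set (List Bool)) : ℝ :=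
  ∑' w : L, wordProb p (w : List Bool)

/-- A language has the prefix property if no word of it is a proper prefix
of another word of it. -/
def PrefixFree (L : Set (List Bool)) : Prop :=
  ∀ u ∈ L, ∀ v ∈ L, u ≠ v → ¬ u <+: v

section WordProb

variable {p : ℝ}

theorem wordProb_append (u v : List Bool) :
    wordProb p (u ++ v) = wordProb p u * wordProb p v := by
  simp only [wordProb, List.count_append, pow_add]
  ring

theorem wordProb_cons (a : Bool) (w : List Bool) :
    wordProb p (a :: w) = (if a then p else 1 - p) * wordProb p w := by
  cases a <;> simp [wordProb, pow_succ] <;> ring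

@[simp] theorem wordProb_nil : wordProb p [] = 1 := by simp [wordProb]

theorem wordProb_nonneg (hp : p ∈ Set.Ioo (0 : ℝ) 1) (w : List Bool) : 0 ≤ wordProb p w :=
  mul_nonneg (pow_nonneg hp.1.le _) (pow_nonneg (sub_nonneg.2 hp.2.le) _)

/-- Kraft's inequality for a biased coin. -/
theorem PrefixFree.sum_wordProb_le_one (hp : p ∈ Set.Ioo (0 : ℝ) 1) (n : ℕ)
    {S : Finset (List Bool)} (hS : PrefixFree (S : Set (List Bool)))
    (hn : ∀ w ∈ S, w.length ≤ n) : ∑ w ∈ S, wordProb p w ≤ 1 := by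
  by_cases hnil : [] ∈ S
  · have : S = {[]} := Finset.eq_singleton_iff_unique_mem.2
      ⟨hnil, fun w hw ↦ by_contra fun h ↦ hS [] hnil w hw (Ne.symm h) ⟨w, rfl⟩⟩
    simp [this]
  induction n generalizing S with
  | zero =>
    have : S = ∅ := Finset.eq_empty_of_forall_notMem fun w hw ↦
      hnil (List.eq_nil_of_length_eq_zero (Nat.le_zero.1 (hn w hw)) ▸ hw)
    simp [this]
  | succ n ih =>
    let T (a : Bool) : Finset (List Bool) :=
      S.preimage (a :: ·) (List.cons_injective.injOn)
    have hT (a : Bool) : ∑ w ∈ T a, wordProb p w ≤ 1 := by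
      have hpre : PrefixFree (T a : Set (List Bool)) := fun u hu v hv huv h ↦
        hS (a :: u) (by simpa [T] using hu) (a :: v) (by simpa [T] using hv)
          (by simpa using huv) (by simpa using h)
      by_cases hmem : [] ∈ T a
      · have : T a = {[]} := Finset.eq_singleton_iff_unique_mem.2
          ⟨hmem, fun w hw ↦ by_contra fun h ↦ hpre [] hmem w hw (Ne.symm h) ⟨w, rfl⟩⟩
        simp [this]
      · exact ih hpre (fun w hw ↦ by simpa using hn (a :: w) (by simpa [T] using hw)) hmem
    have hsum : ∑ w ∈ S, wordProb p w = ∑ a : Bool, ∑ w ∈ T a, wordProb p (a :: w) := by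
      rw [Finset.sum_sigma']
      symm
      refine Finset.sum_nbij (fun x ↦ x.1 :: x.2) ?_ ?_ ?_ ?_
      · intro x hx
        simpa [T] using hx
      · rintro ⟨a, u⟩ - ⟨b, v⟩ - h
        simpa using h
      · intro w hw
        cases w with
        | nil => exact absurd hw hnil
        | cons a w => exact ⟨⟨a, w⟩, by simpa [T] using hw, rfl⟩
      · intros
        rfl
    simp only [hsum, wordProb_cons, ← Finset.mul_sum, Fintype.sum_bool, if_true,
      Bool.false_eq_true, if_false]
    nlinarith [hT true, hT false, hp.1, hp.2]

theorem PrefixFree.tsum_wordProb_le_one (hp : p ∈ Set.Ioo (0 : ℝ) 1) {L : Set (List Bool)}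
    (hL : PrefixFree L) : ∑' w : L, ENNReal.ofReal (wordProb p w) ≤ 1 := by
  refine ENNReal.summable.tsum_le_of_sum_le fun S ↦ ?_
  rw [← ENNReal.ofReal_sum_of_nonneg fun (w : L) _ ↦ wordProb_nonneg hp (w : List Bool),
    ENNReal.ofReal_le_one]
  have hmap := Finset.sum_map S (Function.Embedding.subtype (· ∈ L)) (wordProb p)
  simp only [Function.Embedding.subtype_apply] at hmap
  rw [← hmap]
  have hsub : ∀ w ∈ S.map (Function.Embedding.subtype (· ∈ L)), w ∈ L := by
    simp +contextual
  exact PrefixFree.sum_wordProb_le_one hp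
    ((S.map (Function.Embedding.subtype (· ∈ L))).sup List.length)
    (fun u hu v hv ↦ hL u (hsub u hu) v (hsub v hv)) fun w hw ↦ Finset.le_sup (f := List.length) hw

theorem langProb_eq_toReal (hp : p ∈ Set.Ioo (0 : ℝ) 1) (L : Set (List Bool)) :
    langProb p L = (∑' w : L, ENNReal.ofReal (wordProb p w)).toReal := by
  rw [ENNReal.tsum_toReal_eq fun _ ↦ ENNReal.ofReal_ne_top]
  simp only [ENNReal.toReal_ofReal (wordProb_nonneg hp _), langProb]

end WordProb

section Closure

variable {T : Type*} {g : ContextFreeGrammar T}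

/-- The language of words matched by a symbol, given a language for every nonterminal. -/
def Symbol.interpret {N : Type*} (L : N → Language T) : Symbol T N → Language T
  | .terminal a => {[a]}
  | .nonterminal b => L b

theorem Symbol.prod_interpret_terminal {N : Type*} (L : N → Language T) (w : List T) :
    ((w.map Symbol.terminal).map (Symbol.interpret L)).prod = {w} := by
  induction w with
  | nil => rfl
  | cons a w ih =>
    rw [List.map_cons, List.map_cons, List.prod_cons, ih]
    exact Set.image2_singleton

/-- A family of languages closed under the rules of a grammar contains everything the grammar
derives. -/
theorem ContextFreeGrammar.Derives.mem_of_closed {L : g.NT → Language T}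
    (hL : ∀ r ∈ g.rules, (r.output.map (Symbol.interpret L)).prod ≤ L r.input)
    {b : g.NT} {w : List T} (h : g.Derives [.nonterminal b] (w.map .terminal)) : w ∈ L b := by
  have key : ∀ {s t}, g.Derives s t →
      (t.map (Symbol.interpret L)).prod ≤ (s.map (Symbol.interpret L)).prod := by
    intro s t hst
    induction hst with
    | refl => exact le_rfl
    | tail _ hstep ih =>
      obtain ⟨r, hr, hrw⟩ := hstep
      obtain ⟨u, v, rfl, rfl⟩ := hrw.exists_parts
      refine le_trans ?_ ih
      simp only [List.map_append, List.prod_append, List.map_cons, List.map_nil, List.prod_cons,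
        List.prod_nil, mul_one]
      gcongr
      exact hL r hr
  have := key h
  rw [Symbol.prod_interpret_terminal, List.map_singleton, List.prod_singleton] at this
  exact this (Set.mem_singleton w)

end Closure

/-- Runs of a recursive procedure simulating a `√p`-coin from a `p`-coin, indexed by their output.
A fair coin is obtained from two distinct consecutive tosses. If these are `10`, the next toss is
the output; if they are `01`, the output is the disjunction of the outputs of two recursive
calls, the second of which is skipped when the first one outputs one. -/
inductive SqrtRun : Bool → Type
  | retry (a : Bool) {b : Bool} (t : SqrtRun b) : SqrtRun b
  | toss (b : Bool) : SqrtRun b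
  | halt (t : SqrtRun true) : SqrtRun true
  | resume (s : SqrtRun false) {b : Bool} (t : SqrtRun b) : SqrtRun b

namespace SqrtRun

/-- The tosses consumed by a run. -/
def tosses : {b : Bool} → SqrtRun b → List Bool
  | _, retry a t => a :: a :: t.tosses
  | _, toss b => [true, false, b]
  | _, halt t => false :: true :: t.tosses
  | _, resume s t => false :: true :: (s.tosses ++ t.tosses)

theorem eq_of_tosses_append_eq {b : Bool} (s : SqrtRun b) : ∀ {c : Bool} (t : SqrtRun c)
    {x y : List Bool}, s.tosses ++ x = t.tosses ++ y →
      (⟨b, s⟩ : Σ b, SqrtRun b) = ⟨c, t⟩ ∧ x = y := by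
  induction s with
  | retry a s ih =>
    intro c t x y h
    cases t with
    | retry a' t =>
      simp only [tosses, List.cons_append, List.cons.injEq] at h
      obtain ⟨rfl, -, h⟩ := h
      obtain ⟨hst, rfl⟩ := ih t h
      clear h
      cases hst
      exact ⟨rfl, rfl⟩
    | _ => cases a <;> simp [tosses] at h
  | toss b =>
    intro c t x y h
    cases t with
    | toss =>
      obtain ⟨rfl, rfl⟩ : b = c ∧ x = y := by simpa [tosses] using h
      exact ⟨rfl, rfl⟩
    | retry a' t => cases a' <;> simp [tosses] at h
    | _ => simp [tosses] at h
  | halt s ih =>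
    intro c t x y h
    cases t with
    | halt t =>
      obtain ⟨hst, rfl⟩ := ih t (by simpa [tosses] using h)
      clear h
      cases hst
      exact ⟨rfl, rfl⟩
    | resume t₁ t₂ =>
      have := ih t₁ (x := x) (y := t₂.tosses ++ y) (by simpa [tosses] using h)
      simp at this
    | retry a' t => cases a' <;> simp [tosses] at h
    | toss => simp [tosses] at h
  | resume s₁ s₂ ih₁ ih₂ =>
    intro c t x y h
    cases t with
    | halt t =>
      have := ih₁ t (x := s₂.tosses ++ x) (y := y) (by simpa [tosses] using h)
      simp at this
    | resume t₁ t₂ =>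
      obtain ⟨h₁, h₂⟩ := ih₁ t₁ (x := s₂.tosses ++ x) (y := t₂.tosses ++ y)
        (by simpa [tosses] using h)
      clear h
      cases h₁
      obtain ⟨hst, rfl⟩ := ih₂ t₂ h₂
      clear h₂
      cases hst
      exact ⟨rfl, rfl⟩
    | retry a' t => cases a' <;> simp [tosses] at h
    | toss => simp [tosses] at h

theorem tosses_injective (b : Bool) : Function.Injective (tosses (b := b)) := fun s t h ↦ by
  simpa using (eq_of_tosses_append_eq s t (congrArg (· ++ []) h)).1

/-- The words on which the procedure halts with output `b`. -/
def lang (b : Bool) : Set (List Bool) := Set.range (tosses (b := b))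

theorem disjoint_lang : Disjoint (lang false) (lang true) := by
  rw [Set.disjoint_left]
  rintro _ ⟨s, rfl⟩ ⟨t, h⟩
  have := (eq_of_tosses_append_eq t s (congrArg (· ++ []) h)).1
  simp at this

theorem prefixFree_lang : PrefixFree (lang false ∪ lang true) := by
  have hmem : ∀ w ∈ lang false ∪ lang true, ∃ b, ∃ t : SqrtRun b, t.tosses = w := by
    rintro w (⟨t, rfl⟩ | ⟨t, rfl⟩) <;> exact ⟨_, t, rfl⟩
  intro u hu v hv huv ⟨x, hx⟩
  obtain ⟨b, s, rfl⟩ := hmem u hu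
  obtain ⟨c, t, rfl⟩ := hmem v hv
  obtain ⟨-, rfl⟩ := eq_of_tosses_append_eq s t (x := x) (y := []) (by simpa using hx)
  exact huv (by simpa using hx)

/-- The rewrite rules generating the tosses of runs. -/
def rules : Finset (ContextFreeRule Bool Bool) :=
  Finset.univ.biUnion fun c ↦
    { ⟨c, [.terminal true, .terminal true, .nonterminal c]⟩,
      ⟨c, [.terminal false, .terminal false, .nonterminal c]⟩,
      ⟨c, [.terminal true, .terminal false, .terminal c]⟩,
      ⟨true, [.terminal false, .terminal true, .nonterminal true]⟩,
      ⟨c, [.terminal false, .terminal true, .nonterminal false, .nonterminal c]⟩ }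

theorem mem_rules {r : ContextFreeRule Bool Bool} : r ∈ rules ↔ ∃ c,
    r = ⟨c, [.terminal true, .terminal true, .nonterminal c]⟩ ∨
    r = ⟨c, [.terminal false, .terminal false, .nonterminal c]⟩ ∨
    r = ⟨c, [.terminal true, .terminal false, .terminal c]⟩ ∨
    r = ⟨true, [.terminal false, .terminal true, .nonterminal true]⟩ ∨
    r = ⟨c, [.terminal false, .terminal true, .nonterminal false, .nonterminal c]⟩ := by
  simp only [rules, Finset.mem_biUnion, Finset.mem_univ, true_and, Finset.mem_insert,
    Finset.mem_singleton]

/-- The grammar of runs with output `b`. -/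
abbrev grammar (b : Bool) : ContextFreeGrammar Bool := ⟨Bool, b, rules⟩

theorem derives_tosses (b₀ : Bool) {b : Bool} (t : SqrtRun b) :
    (grammar b₀).Derives [.nonterminal b] (t.tosses.map .terminal) := by
  have start (r : ContextFreeRule Bool Bool) (hr : r ∈ rules) :
      (grammar b₀).Derives [.nonterminal r.input] r.output :=
    ContextFreeGrammar.Produces.single ⟨r, hr, ContextFreeRule.Rewrites.input_output⟩
  induction t with
  | @retry a b t ih =>
    refine (start ⟨b, [.terminal a, .terminal a, .nonterminal b]⟩ ?_).trans
      (ih.append_left [.terminal a, .terminal a])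
    exact mem_rules.2 ⟨b, by cases a <;> simp⟩
  | toss b =>
    exact start ⟨b, [.terminal true, .terminal false, .terminal b]⟩ (mem_rules.2 ⟨b, by simp⟩)
  | halt t ih =>
    exact (start ⟨true, [.terminal false, .terminal true, .nonterminal true]⟩
      (mem_rules.2 ⟨true, by simp⟩)).trans (ih.append_left [.terminal false, .terminal true])
  | @resume s b t ih₁ ih₂ =>
    refine (start ⟨b, [.terminal false, .terminal true, .nonterminal false, .nonterminal b]⟩
      (mem_rules.2 ⟨b, by simp⟩)).trans ?_
    simp only [tosses, List.map_cons, List.map_append]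
    exact ((ih₁.append_right [.nonterminal b]).trans
      (ih₂.append_left (s.tosses.map .terminal))).append_left [.terminal false, .terminal true]

theorem isContextFree_lang (b : Bool) : Language.IsContextFree (lang b : Language Bool) := by
  refine ⟨grammar b, Set.Subset.antisymm (fun w hw ↦ ?_) ?_⟩
  · refine ContextFreeGrammar.Derives.mem_of_closed (g := grammar b) (L := lang) ?_ hw
    intro r hr w hw
    obtain ⟨c, rfl | rfl | rfl | rfl | rfl⟩ := mem_rules.1 hr <;>
      simp only [List.map_cons, List.map_nil, List.prod_cons, List.prod_nil, mul_one] at hw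
    · obtain ⟨_, rfl, _, ⟨_, rfl, _, ⟨t, rfl⟩, rfl⟩, rfl⟩ := hw
      exact ⟨retry true t, rfl⟩
    · obtain ⟨_, rfl, _, ⟨_, rfl, _, ⟨t, rfl⟩, rfl⟩, rfl⟩ := hw
      exact ⟨retry false t, rfl⟩
    · obtain ⟨_, rfl, _, ⟨_, rfl, _, rfl, rfl⟩, rfl⟩ := hw
      exact ⟨toss c, rfl⟩
    · obtain ⟨_, rfl, _, ⟨_, rfl, _, ⟨t, rfl⟩, rfl⟩, rfl⟩ := hw
      exact ⟨halt t, rfl⟩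
    · obtain ⟨_, rfl, _, ⟨_, rfl, _, ⟨_, ⟨s, rfl⟩, _, ⟨t, rfl⟩, rfl⟩, rfl⟩, rfl⟩ := hw
      exact ⟨resume s t, rfl⟩
  · rintro _ ⟨t, rfl⟩
    exact derives_tosses b t

/-- Case analysis on the first step of a run with output zero. -/
def equivFalse :
    SqrtRun false ≃ (Bool × SqrtRun false) ⊕ Unit ⊕ (SqrtRun false × SqrtRun false) where
  toFun
    | retry a t => .inl (a, t)
    | toss _ => .inr (.inl ())
    | resume s t => .inr (.inr (s, t))
  invFun
    | .inl (a, t) => retry a t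
    | .inr (.inl _) => toss false
    | .inr (.inr (s, t)) => resume s t
  left_inv t := by cases t <;> rfl
  right_inv := by rintro (_ | _ | _) <;> rfl

/-- Case analysis on the first step of a run with output one. -/
def equivTrue : SqrtRun true ≃
    (Bool × SqrtRun true) ⊕ Unit ⊕ SqrtRun true ⊕ (SqrtRun false × SqrtRun true) where
  toFun
    | retry a t => .inl (a, t)
    | toss _ => .inr (.inl ())
    | halt t => .inr (.inr (.inl t))
    | resume s t => .inr (.inr (.inr (s, t)))
  invFun
    | .inl (a, t) => retry a t
    | .inr (.inl _) => toss true
    | .inr (.inr (.inl t)) => halt t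
    | .inr (.inr (.inr (s, t))) => resume s t
  left_inv t := by cases t <;> rfl
  right_inv := by rintro (_ | _ | _ | _) <;> rfl

section Prob

variable {p : ℝ}

theorem _root_.HasSum.mul_of_nonneg {ι κ : Type*} {f : ι → ℝ} {g : κ → ℝ} {a b : ℝ}
    (hf : HasSum f a) (hg : HasSum g b) (hf₀ : 0 ≤ f) (hg₀ : 0 ≤ g) :
    HasSum (fun x : ι × κ ↦ f x.1 * g x.2) (a * b) :=
  hf.mul hg (hf.summable.mul_of_nonneg hg.summable hf₀ hg₀)

theorem hasSum_tosses (hp : p ∈ Set.Ioo (0 : ℝ) 1) (b : Bool) :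
    HasSum (fun t : SqrtRun b ↦ wordProb p t.tosses) (langProb p (lang b)) := by
  have hL : PrefixFree (lang b) := fun u hu v hv ↦
    prefixFree_lang u (by cases b <;> simp [hu]) v (by cases b <;> simp [hv])
  have hs : Summable fun w : lang b ↦ wordProb p w := by
    have := ENNReal.summable_toReal
      ((hL.tsum_wordProb_le_one hp).trans_lt ENNReal.one_lt_top).ne
    simpa only [ENNReal.toReal_ofReal (wordProb_nonneg hp _)] using this
  exact (Equiv.ofInjective _ (tosses_injective b)).hasSum_iff.2 hs.hasSum

theorem langProb_union (hp : p ∈ Set.Ioo (0 : ℝ) 1) :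
    langProb p (lang false ∪ lang true) = langProb p (lang false) + langProb p (lang true) :=
  Summable.tsum_union_disjoint disjoint_lang
    ((Equiv.ofInjective _ (tosses_injective false)).summable_iff.1 (hasSum_tosses hp _).summable)
    ((Equiv.ofInjective _ (tosses_injective true)).summable_iff.1 (hasSum_tosses hp _).summable)

theorem hasSum_retry (hp : p ∈ Set.Ioo (0 : ℝ) 1) (b : Bool) :
    HasSum (fun x : Bool × SqrtRun b ↦ wordProb p (retry x.1 x.2).tosses)
      ((p ^ 2 + (1 - p) ^ 2) * langProb p (lang b)) := by
  have h := HasSum.mul_of_nonneg (hasSum_fintype fun a : Bool ↦ (if a then p else 1 - p) ^ 2)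
    (hasSum_tosses hp b) (fun _ ↦ sq_nonneg _) (fun _ ↦ wordProb_nonneg hp _)
  convert! h using 2
  · simp only [tosses, wordProb_cons]
    ring
  · simp

theorem hasSum_resume (hp : p ∈ Set.Ioo (0 : ℝ) 1) (b : Bool) :
    HasSum (fun x : SqrtRun false × SqrtRun b ↦ wordProb p (resume x.1 x.2).tosses)
      (p * (1 - p) * (langProb p (lang false) * langProb p (lang b))) := by
  have h := ((hasSum_tosses hp false).mul_of_nonneg (hasSum_tosses hp b)
    (fun _ ↦ wordProb_nonneg hp _) (fun _ ↦ wordProb_nonneg hp _)).mul_left (p * (1 - p))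
  convert! h using 2
  simp only [tosses, wordProb_cons, wordProb_append]
  simp
  ring

theorem hasSum_halt (hp : p ∈ Set.Ioo (0 : ℝ) 1) :
    HasSum (fun t : SqrtRun true ↦ wordProb p (halt t).tosses)
      (p * (1 - p) * langProb p (lang true)) := by
  convert! (hasSum_tosses hp true).mul_left (p * (1 - p)) using 2
  simp only [tosses, wordProb_cons]
  simp
  ring

theorem hasSum_toss (b : Bool) :
    HasSum (fun _ : Unit ↦ wordProb p (toss b).tosses)
      (p * (1 - p) * if b then p else 1 - p) := by
  convert! hasSum_unique (fun _ : Unit ↦ wordProb p (toss b).tosses) using 1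
  simp [tosses, wordProb_cons, mul_assoc]

theorem langProb_false (hp : p ∈ Set.Ioo (0 : ℝ) 1) :
    langProb p (lang false) = (p ^ 2 + (1 - p) ^ 2) * langProb p (lang false) +
      (p * (1 - p) * (1 - p) + p * (1 - p) * (langProb p (lang false) * langProb p (lang false))) := by
  refine (hasSum_tosses hp false).unique (equivFalse.symm.hasSum_iff.1 ?_)
  refine .sum ?_ (.sum ?_ ?_)
  · exact hasSum_retry hp false
  · exact hasSum_toss false
  · exact hasSum_resume hp false

theorem langProb_true (hp : p ∈ Set.Ioo (0 : ℝ) 1) :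
    langProb p (lang true) = (p ^ 2 + (1 - p) ^ 2) * langProb p (lang true) +
      (p * (1 - p) * p + (p * (1 - p) * langProb p (lang true) +
        p * (1 - p) * (langProb p (lang false) * langProb p (lang true)))) := by
  refine (hasSum_tosses hp true).unique (equivTrue.symm.hasSum_iff.1 ?_)
  refine .sum ?_ (.sum ?_ (.sum ?_ ?_))
  · exact hasSum_retry hp true
  · exact hasSum_toss true
  · exact hasSum_halt hp
  · exact hasSum_resume hp true

theorem langProb_false_eq (hp : p ∈ Set.Ioo (0 : ℝ) 1) :
    langProb p (lang false) = 1 - √p := by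
  have hpq : p * (1 - p) ≠ 0 := (mul_pos hp.1 (sub_pos.2 hp.2)).ne'
  have hsq : (1 - langProb p (lang false)) ^ 2 = p :=
    mul_left_cancel₀ hpq (by linear_combination -(langProb_false hp))
  have hle : langProb p (lang false) + langProb p (lang true) ≤ 1 := by
    rw [← langProb_union hp, langProb_eq_toReal hp]
    exact ENNReal.toReal_le_of_le_ofReal zero_le_one
      (by simpa using prefixFree_lang.tsum_wordProb_le_one hp)
  have hnonneg : 0 ≤ langProb p (lang true) := tsum_nonneg fun _ ↦ wordProb_nonneg hp _
  nth_rw 2 [← hsq]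
  rw [Real.sqrt_sq (by linarith)]
  ring

theorem langProb_true_eq (hp : p ∈ Set.Ioo (0 : ℝ) 1) : langProb p (lang true) = √p := by
  have hpq : p * (1 - p) ≠ 0 := (mul_pos hp.1 (sub_pos.2 hp.2)).ne'
  have h := langProb_true hp
  rw [langProb_false_eq hp] at h
  have hmul : √p * langProb p (lang true) = √p * √p := by
    rw [Real.mul_self_sqrt hp.1.le]
    exact mul_left_cancel₀ hpq (by linear_combination h)
  exact mul_left_cancel₀ (Real.sqrt_pos.2 hp.1).ne' hmul

end Prob

end SqrtRun

theorem stmt_14 :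
    ∃ L₀ L₁ : Set (List Bool),
      Language.IsContextFree (L₀ : Language Bool) ∧
      Language.IsContextFree (L₁ : Language Bool) ∧
      Disjoint L₀ L₁ ∧
      PrefixFree (L₀ ∪ L₁) ∧
      ∀ p ∈ Set.Ioo (0:ℝ) 1,
        langProb p (L₀ ∪ L₁) = 1 ∧ langProb p L₁ = Real.sqrt p := by
  refine ⟨SqrtRun.lang false, SqrtRun.lang true, SqrtRun.isContextFree_lang false,
    SqrtRun.isContextFree_lang true, SqrtRun.disjoint_lang, SqrtRun.prefixFree_lang,
    fun p hp ↦ ⟨?_, SqrtRun.langProb_true_eq hp⟩⟩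
  rw [SqrtRun.langProb_union hp, SqrtRun.langProb_false_eq hp, SqrtRun.langProb_true_eq hp,
    sub_add_cancel]
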